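/- Assume cᵢ ≥ 0 and ℓᵢ > 0 for i = 1,2,3, the ordering condition (Ω′), and c₁/ℓ₁ ≥ 1. Then Vol₄(P_H(c,ℓ)) = (8/3)·ℓ₁²ℓ₂²ℓ₃²·(c₁/ℓ₁ + 2c₂/ℓ₂ + 2c₃/ℓ₃). -/

import Mathlib

open MeasureTheory

/-- The convex hull of the graph of the trilinear monomial `x₁x₂x₃` over the box
`[c₁-ℓ₁, c₁+ℓ₁] × [c₂-ℓ₂, c₂+ℓ₂] × [c₃-ℓ₃, c₃+ℓ₃]`, viewed in `ℝ⁴`. -/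
noncomputable def PH (c₁ c₂ c₃ ℓ₁ ℓ₂ ℓ₃ : ℝ) : Set (Fin 4 → ℝ) :=
  convexHull ℝ {p : Fin 4 → ℝ | ∃ x₁ x₂ x₃ : ℝ,
    x₁ ∈ Set.Icc (c₁ - ℓ₁) (c₁ + ℓ₁) ∧ x₂ ∈ Set.Icc (c₂ - ℓ₂) (c₂ + ℓ₂) ∧
    x₃ ∈ Set.Icc (c₃ - ℓ₃) (c₃ + ℓ₃) ∧ p = ![x₁ * x₂ * x₃, x₁, x₂, x₃]}

/-- The trilinear monomial on the unit cube, after rescaling and removing its affine part. -/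
def unitTrilinear (r₁ r₂ r₃ y₁ y₂ y₃ : ℝ) : ℝ :=
  y₁ * y₂ * y₃ + r₁ * (y₂ * y₃) + r₂ * (y₁ * y₃) + r₃ * (y₁ * y₂)

/-- The graph of `unitTrilinear` over the unit cube. -/
def unitGraph (r₁ r₂ r₃ : ℝ) : Set (Fin 4 → ℝ) :=
  {p | ∃ y₁ y₂ y₃ : ℝ, y₁ ∈ Set.Icc (0 : ℝ) 1 ∧ y₂ ∈ Set.Icc (0 : ℝ) 1 ∧
    y₃ ∈ Set.Icc (0 : ℝ) 1 ∧ p = ![unitTrilinear r₁ r₂ r₃ y₁ y₂ y₃, y₁, y₂, y₃]}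

/-- The concave envelope of `unitTrilinear` on the unit cube for nonnegative parameters. -/
noncomputable def upperEnv (r₁ r₂ r₃ y₁ y₂ y₃ : ℝ) : ℝ :=
  min (min y₁ y₂) y₃ + r₁ * min y₂ y₃ + r₂ * min y₁ y₃ + r₃ * min y₁ y₂

/-- The convex envelope of `unitTrilinear` on the unit cube for `0 ≤ r₁ ≤ r₂ ≤ r₃`. -/
noncomputable def lowerEnv (r₁ r₂ r₃ y₁ y₂ y₃ : ℝ) : ℝ :=
  r₁ * max 0 (y₁ + y₂ + y₃ - 1) + (1 + r₁) * max 0 (y₁ + y₂ + y₃ - 2) +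
    (r₂ - r₁) * max 0 (y₁ + y₃ - 1) + (r₃ - r₁) * max 0 (y₁ + y₂ - 1)

/-- The region between the two envelopes over the unit cube. -/
def envRegion (r₁ r₂ r₃ : ℝ) : Set (Fin 4 → ℝ) :=
  {p | p 1 ∈ Set.Icc (0 : ℝ) 1 ∧ p 2 ∈ Set.Icc (0 : ℝ) 1 ∧ p 3 ∈ Set.Icc (0 : ℝ) 1 ∧
    lowerEnv r₁ r₂ r₃ (p 1) (p 2) (p 3) ≤ p 0 ∧ p 0 ≤ upperEnv r₁ r₂ r₃ (p 1) (p 2) (p 3)}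

lemma max_zero_convex_comb {a b x y z : ℝ} (ha : 0 ≤ a) (hb : 0 ≤ b) (hz : z = a * x + b * y) :
    max 0 z ≤ a * max 0 x + b * max 0 y := by
  have hx := mul_le_mul_of_nonneg_left (le_max_right 0 x) ha
  have hy := mul_le_mul_of_nonneg_left (le_max_right 0 y) hb
  exact max_le (by positivity) (by linarith)

lemma min_concave_comb {a b x y x' y' u v : ℝ} (ha : 0 ≤ a) (hb : 0 ≤ b)
    (hu : a * x + b * y ≤ u) (hv : a * x' + b * y' ≤ v) :
    a * min x x' + b * min y y' ≤ min u v := by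
  have h₁ := mul_le_mul_of_nonneg_left (min_le_left x x') ha
  have h₂ := mul_le_mul_of_nonneg_left (min_le_left y y') hb
  have h₃ := mul_le_mul_of_nonneg_left (min_le_right x x') ha
  have h₄ := mul_le_mul_of_nonneg_left (min_le_right y y') hb
  exact le_min (by linarith) (by linarith)

lemma convex_envRegion {r₁ r₂ r₃ : ℝ} (h₁ : 0 ≤ r₁) (h₁₂ : r₁ ≤ r₂) (h₂₃ : r₂ ≤ r₃) :
    Convex ℝ (envRegion r₁ r₂ r₃) := by
  rintro p ⟨hp₁, hp₂, hp₃, hpL, hpU⟩ q ⟨hq₁, hq₂, hq₃, hqL, hqU⟩ a b ha hb hab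
  refine ⟨convex_Icc 0 1 hp₁ hq₁ ha hb hab, convex_Icc 0 1 hp₂ hq₂ ha hb hab,
    convex_Icc 0 1 hp₃ hq₃ ha hb hab, ?_, ?_⟩
  · have hL₁ := mul_le_mul_of_nonneg_left hpL ha
    have hL₂ := mul_le_mul_of_nonneg_left hqL hb
    refine le_trans ?_ (add_le_add hL₁ hL₂)
    simp only [lowerEnv, Pi.add_apply, Pi.smul_apply, smul_eq_mul]
    have key₁ := mul_le_mul_of_nonneg_left (max_zero_convex_comb ha hb
      (x := p 1 + p 2 + p 3 - 1) (y := q 1 + q 2 + q 3 - 1)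
      (z := a * p 1 + b * q 1 + (a * p 2 + b * q 2) + (a * p 3 + b * q 3) - 1)
      (by linear_combination hab)) h₁
    have key₂ := mul_le_mul_of_nonneg_left (max_zero_convex_comb ha hb
      (x := p 1 + p 2 + p 3 - 2) (y := q 1 + q 2 + q 3 - 2)
      (z := a * p 1 + b * q 1 + (a * p 2 + b * q 2) + (a * p 3 + b * q 3) - 2)
      (by linear_combination 2 * hab)) (show 0 ≤ 1 + r₁ by linarith)
    have key₃ := mul_le_mul_of_nonneg_left (max_zero_convex_comb ha hb
      (x := p 1 + p 3 - 1) (y := q 1 + q 3 - 1)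
      (z := a * p 1 + b * q 1 + (a * p 3 + b * q 3) - 1)
      (by linear_combination hab)) (sub_nonneg.2 h₁₂)
    have key₄ := mul_le_mul_of_nonneg_left (max_zero_convex_comb ha hb
      (x := p 1 + p 2 - 1) (y := q 1 + q 2 - 1)
      (z := a * p 1 + b * q 1 + (a * p 2 + b * q 2) - 1)
      (by linear_combination hab)) (show 0 ≤ r₃ - r₁ by linarith)
    linarith
  · have hU₁ := mul_le_mul_of_nonneg_left hpU ha
    have hU₂ := mul_le_mul_of_nonneg_left hqU hb
    refine le_trans (add_le_add hU₁ hU₂) ?_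
    simp only [upperEnv, Pi.add_apply, Pi.smul_apply, smul_eq_mul]
    have key (i j : Fin 4) := min_concave_comb ha hb
      (le_refl (a * p i + b * q i)) (le_refl (a * p j + b * q j))
    have key₀ := min_concave_comb ha hb (key 1 2) (le_refl (a * p 3 + b * q 3))
    have key₁ := mul_le_mul_of_nonneg_left (key 2 3) h₁
    have key₂ := mul_le_mul_of_nonneg_left (key 1 3) (h₁.trans h₁₂)
    have key₃ := mul_le_mul_of_nonneg_left (key 1 2) (h₁.trans (h₁₂.trans h₂₃))
    linarith

lemma unitTrilinear_le_upperEnv {r₁ r₂ r₃ y₁ y₂ y₃ : ℝ} (h₁ : 0 ≤ r₁) (h₂ : 0 ≤ r₂)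
    (h₃ : 0 ≤ r₃) (hy₁ : y₁ ∈ Set.Icc (0 : ℝ) 1) (hy₂ : y₂ ∈ Set.Icc (0 : ℝ) 1)
    (hy₃ : y₃ ∈ Set.Icc (0 : ℝ) 1) :
    unitTrilinear r₁ r₂ r₃ y₁ y₂ y₃ ≤ upperEnv r₁ r₂ r₃ y₁ y₂ y₃ := by
  have key {x y : ℝ} (hx : x ∈ Set.Icc (0 : ℝ) 1) (hy : y ∈ Set.Icc (0 : ℝ) 1) :
      x * y ≤ min x y :=
    le_min (mul_le_of_le_one_right hx.1 hy.2) (mul_le_of_le_one_left hy.1 hx.2)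
  have h₀ := (key ⟨mul_nonneg hy₁.1 hy₂.1, mul_le_one₀ hy₁.2 hy₂.1 hy₂.2⟩ hy₃).trans
    (min_le_min_right y₃ (key hy₁ hy₂))
  unfold unitTrilinear upperEnv
  gcongr
  exacts [key hy₂ hy₃, key hy₁ hy₃, key hy₁ hy₂]

lemma lowerEnv_le_unitTrilinear {r₁ r₂ r₃ y₁ y₂ y₃ : ℝ} (h₁ : 0 ≤ r₁) (h₁₂ : r₁ ≤ r₂)
    (h₂₃ : r₂ ≤ r₃) (hy₁ : y₁ ∈ Set.Icc (0 : ℝ) 1) (hy₂ : y₂ ∈ Set.Icc (0 : ℝ) 1)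
    (hy₃ : y₃ ∈ Set.Icc (0 : ℝ) 1) :
    lowerEnv r₁ r₂ r₃ y₁ y₂ y₃ ≤ unitTrilinear r₁ r₂ r₃ y₁ y₂ y₃ := by
  obtain ⟨a₁, b₁⟩ := hy₁
  obtain ⟨a₂, b₂⟩ := hy₂
  obtain ⟨a₃, b₃⟩ := hy₃
  have n₁₂ := mul_nonneg a₁ a₂
  have n₁₃ := mul_nonneg a₁ a₃
  have n₂₃ := mul_nonneg a₂ a₃
  have n := mul_nonneg n₁₂ a₃
  have m₁₂ := mul_nonneg (sub_nonneg.2 b₁) (sub_nonneg.2 b₂)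
  have m₁₃ := mul_nonneg (sub_nonneg.2 b₁) (sub_nonneg.2 b₃)
  have m₂₃ := mul_nonneg (sub_nonneg.2 b₂) (sub_nonneg.2 b₃)
  have m := mul_nonneg m₁₂ (sub_nonneg.2 b₃)
  have k₁₂ := mul_nonneg m₁₂ a₃
  have k₁₃ := mul_nonneg a₁ m₂₃
  have e₁₂ : max 0 (y₁ + y₂ - 1) ≤ y₁ * y₂ := max_le n₁₂ (by linarith)
  have e₁₃ : max 0 (y₁ + y₃ - 1) ≤ y₁ * y₃ := max_le n₁₃ (by linarith)
  have e : max 0 (y₁ + y₂ + y₃ - 2) ≤ y₁ * y₂ * y₃ :=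
    max_le n (by nlinarith [mul_nonneg (sub_nonneg.2 b₃) (sub_nonneg.2 (mul_le_one₀ b₁ a₂ b₂))])
  have e' : max 0 (y₁ + y₂ + y₃ - 1) + max 0 (y₁ + y₂ + y₃ - 2) ≤
      y₁ * y₂ + y₁ * y₃ + y₂ * y₃ := by
    rcases max_cases 0 (y₁ + y₂ + y₃ - 1) with ⟨E, _⟩ | ⟨E, _⟩ <;>
    rcases max_cases 0 (y₁ + y₂ + y₃ - 2) with ⟨E', _⟩ | ⟨E', _⟩ <;> rw [E, E'] <;> nlinarith
  have f₁ := mul_le_mul_of_nonneg_left e' h₁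
  have f₂ := mul_le_mul_of_nonneg_left e₁₃ (sub_nonneg.2 h₁₂)
  have f₃ := mul_le_mul_of_nonneg_left e₁₂ (show 0 ≤ r₃ - r₁ by linarith)
  unfold unitTrilinear lowerEnv
  linarith

/-- A convex combination of four points of the graph lies in its convex hull. -/
lemma mem_convexHull_unitGraph {r₁ r₂ r₃ t y₁ y₂ y₃ : ℝ} (w : Fin 4 → ℝ)
    (v : Fin 4 → Fin 3 → ℝ) (hv : ∀ i j, v i j ∈ Set.Icc (0 : ℝ) 1) (hw : ∀ i, 0 ≤ w i)
    (hsum : w 0 + w 1 + w 2 + w 3 = 1)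
    (ht : w 0 * unitTrilinear r₁ r₂ r₃ (v 0 0) (v 0 1) (v 0 2) +
      w 1 * unitTrilinear r₁ r₂ r₃ (v 1 0) (v 1 1) (v 1 2) +
      w 2 * unitTrilinear r₁ r₂ r₃ (v 2 0) (v 2 1) (v 2 2) +
      w 3 * unitTrilinear r₁ r₂ r₃ (v 3 0) (v 3 1) (v 3 2) = t)
    (h₁ : w 0 * v 0 0 + w 1 * v 1 0 + w 2 * v 2 0 + w 3 * v 3 0 = y₁)
    (h₂ : w 0 * v 0 1 + w 1 * v 1 1 + w 2 * v 2 1 + w 3 * v 3 1 = y₂)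
    (h₃ : w 0 * v 0 2 + w 1 * v 1 2 + w 2 * v 2 2 + w 3 * v 3 2 = y₃) :
    ![t, y₁, y₂, y₃] ∈ convexHull ℝ (unitGraph r₁ r₂ r₃) := by
  have key := (convex_convexHull ℝ (unitGraph r₁ r₂ r₃)).sum_mem (t := Finset.univ) (w := w)
    (z := fun i => ![unitTrilinear r₁ r₂ r₃ (v i 0) (v i 1) (v i 2), v i 0, v i 1, v i 2])
    (fun i _ => hw i) (by rw [Fin.sum_univ_four, hsum])
    (fun i _ => subset_convexHull ℝ _ ⟨_, _, _, hv i 0, hv i 1, hv i 2, rfl⟩)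
  convert key using 1
  rw [Fin.sum_univ_four, ← ht, ← h₁, ← h₂, ← h₃]
  ext i
  fin_cases i <;> simp

lemma upperEnv_mem_convexHull (r₁ r₂ r₃ : ℝ) {y₁ y₂ y₃ : ℝ} (hy₁ : y₁ ∈ Set.Icc (0 : ℝ) 1)
    (hy₂ : y₂ ∈ Set.Icc (0 : ℝ) 1) (hy₃ : y₃ ∈ Set.Icc (0 : ℝ) 1) :
    ![upperEnv r₁ r₂ r₃ y₁ y₂ y₃, y₁, y₂, y₃] ∈ convexHull ℝ (unitGraph r₁ r₂ r₃) := by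
  obtain ⟨a₁, b₁⟩ := hy₁
  obtain ⟨a₂, b₂⟩ := hy₂
  obtain ⟨a₃, b₃⟩ := hy₃
  rcases le_total y₁ y₂ with h₁₂ | h₁₂ <;> rcases le_total y₁ y₃ with h₁₃ | h₁₃ <;>
    rcases le_total y₂ y₃ with h₂₃ | h₂₃
  · refine mem_convexHull_unitGraph ![1 - y₃, y₃ - y₂, y₂ - y₁, y₁]
      ![![0, 0, 0], ![0, 0, 1], ![0, 1, 1], ![1, 1, 1]] ?_ ?_ ?_ ?_ ?_ ?_ ?_
    all_goals simp [Fin.forall_fin_succ, unitTrilinear, upperEnv, *]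
    all_goals ring
  · refine mem_convexHull_unitGraph ![1 - y₂, y₂ - y₃, y₃ - y₁, y₁]
      ![![0, 0, 0], ![0, 1, 0], ![0, 1, 1], ![1, 1, 1]] ?_ ?_ ?_ ?_ ?_ ?_ ?_
    all_goals simp [Fin.forall_fin_succ, unitTrilinear, upperEnv, *]
    all_goals ring
  · obtain rfl : y₁ = y₂ := by linarith
    obtain rfl : y₁ = y₃ := by linarith
    refine mem_convexHull_unitGraph ![1 - y₁, 0, 0, y₁]
      ![![0, 0, 0], ![0, 0, 1], ![0, 1, 1], ![1, 1, 1]] ?_ ?_ ?_ ?_ ?_ ?_ ?_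
    all_goals simp [Fin.forall_fin_succ, unitTrilinear, upperEnv, *]
    all_goals ring
  · refine mem_convexHull_unitGraph ![1 - y₂, y₂ - y₁, y₁ - y₃, y₃]
      ![![0, 0, 0], ![0, 1, 0], ![1, 1, 0], ![1, 1, 1]] ?_ ?_ ?_ ?_ ?_ ?_ ?_
    all_goals simp [Fin.forall_fin_succ, unitTrilinear, upperEnv, *]
    all_goals ring
  · refine mem_convexHull_unitGraph ![1 - y₃, y₃ - y₁, y₁ - y₂, y₂]
      ![![0, 0, 0], ![0, 0, 1], ![1, 0, 1], ![1, 1, 1]] ?_ ?_ ?_ ?_ ?_ ?_ ?_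
    all_goals simp [Fin.forall_fin_succ, unitTrilinear, upperEnv, *]
    all_goals ring
  · obtain rfl : y₁ = y₂ := by linarith
    obtain rfl : y₁ = y₃ := by linarith
    refine mem_convexHull_unitGraph ![1 - y₁, 0, 0, y₁]
      ![![0, 0, 0], ![0, 0, 1], ![0, 1, 1], ![1, 1, 1]] ?_ ?_ ?_ ?_ ?_ ?_ ?_
    all_goals simp [Fin.forall_fin_succ, unitTrilinear, upperEnv, *]
    all_goals ring
  · refine mem_convexHull_unitGraph ![1 - y₁, y₁ - y₃, y₃ - y₂, y₂]
      ![![0, 0, 0], ![1, 0, 0], ![1, 0, 1], ![1, 1, 1]] ?_ ?_ ?_ ?_ ?_ ?_ ?_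
    all_goals simp [Fin.forall_fin_succ, unitTrilinear, upperEnv, *]
    all_goals ring
  · refine mem_convexHull_unitGraph ![1 - y₁, y₁ - y₂, y₂ - y₃, y₃]
      ![![0, 0, 0], ![1, 0, 0], ![1, 1, 0], ![1, 1, 1]] ?_ ?_ ?_ ?_ ?_ ?_ ?_
    all_goals simp [Fin.forall_fin_succ, unitTrilinear, upperEnv, *]
    all_goals ring

lemma lowerEnv_mem_convexHull (r₁ r₂ r₃ : ℝ) {y₁ y₂ y₃ : ℝ} (hy₁ : y₁ ∈ Set.Icc (0 : ℝ) 1)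
    (hy₂ : y₂ ∈ Set.Icc (0 : ℝ) 1) (hy₃ : y₃ ∈ Set.Icc (0 : ℝ) 1) :
    ![lowerEnv r₁ r₂ r₃ y₁ y₂ y₃, y₁, y₂, y₃] ∈ convexHull ℝ (unitGraph r₁ r₂ r₃) := by
  obtain ⟨a₁, b₁⟩ := hy₁
  obtain ⟨a₂, b₂⟩ := hy₂
  obtain ⟨a₃, b₃⟩ := hy₃
  unfold lowerEnv
  rcases le_total (y₁ + y₂ + y₃) 1 with h₁ | h₁
  · rw [max_eq_left (by linarith), max_eq_left (by linarith), max_eq_left (by linarith),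
      max_eq_left (by linarith)]
    refine mem_convexHull_unitGraph ![1 - (y₁ + y₂ + y₃), y₁, y₂, y₃]
      ![![0, 0, 0], ![1, 0, 0], ![0, 1, 0], ![0, 0, 1]] ?_ ?_ ?_ ?_ ?_ ?_ ?_
    all_goals simp [Fin.forall_fin_succ, unitTrilinear, *]
    all_goals ring
  rcases le_total 2 (y₁ + y₂ + y₃) with h₂ | h₂
  · rw [max_eq_right (by linarith), max_eq_right (by linarith), max_eq_right (by linarith),
      max_eq_right (by linarith)]
    refine mem_convexHull_unitGraph ![y₁ + y₂ + y₃ - 2, 1 - y₁, 1 - y₂, 1 - y₃]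
      ![![1, 1, 1], ![0, 1, 1], ![1, 0, 1], ![1, 1, 0]] ?_ ?_ ?_ ?_ ?_ ?_ ?_
    all_goals simp [Fin.forall_fin_succ, unitTrilinear, *]
    all_goals ring
  rw [max_eq_right (by linarith : 0 ≤ y₁ + y₂ + y₃ - 1),
    max_eq_left (by linarith : y₁ + y₂ + y₃ - 2 ≤ 0)]
  rcases le_total (y₁ + y₃) 1 with hA | hA <;> rcases le_total (y₁ + y₂) 1 with hB | hB
  · rw [max_eq_left (by linarith), max_eq_left (by linarith)]
    refine mem_convexHull_unitGraph
      ![y₁, 1 - (y₁ + y₃), 1 - (y₁ + y₂), y₁ + y₂ + y₃ - 1]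
      ![![1, 0, 0], ![0, 1, 0], ![0, 0, 1], ![0, 1, 1]] ?_ ?_ ?_ ?_ ?_ ?_ ?_
    all_goals simp [Fin.forall_fin_succ, unitTrilinear, *]
    all_goals ring
  · rw [max_eq_left (by linarith), max_eq_right (by linarith)]
    refine mem_convexHull_unitGraph ![1 - y₂, 1 - (y₁ + y₃), y₃, y₁ + y₂ - 1]
      ![![1, 0, 0], ![0, 1, 0], ![0, 1, 1], ![1, 1, 0]] ?_ ?_ ?_ ?_ ?_ ?_ ?_
    all_goals simp [Fin.forall_fin_succ, unitTrilinear, *]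
    all_goals ring
  · rw [max_eq_right (by linarith), max_eq_left (by linarith)]
    refine mem_convexHull_unitGraph ![1 - y₃, 1 - (y₁ + y₂), y₂, y₁ + y₃ - 1]
      ![![1, 0, 0], ![0, 0, 1], ![0, 1, 1], ![1, 0, 1]] ?_ ?_ ?_ ?_ ?_ ?_ ?_
    all_goals simp [Fin.forall_fin_succ, unitTrilinear, *]
    all_goals ring
  · rw [max_eq_right (by linarith), max_eq_right (by linarith)]
    refine mem_convexHull_unitGraph
      ![2 - (y₁ + y₂ + y₃), 1 - y₁, y₁ + y₃ - 1, y₁ + y₂ - 1]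
      ![![1, 0, 0], ![0, 1, 1], ![1, 0, 1], ![1, 1, 0]] ?_ ?_ ?_ ?_ ?_ ?_ ?_
    all_goals simp [Fin.forall_fin_succ, unitTrilinear, *]
    all_goals ring

lemma convexHull_unitGraph {r₁ r₂ r₃ : ℝ} (h₁ : 0 ≤ r₁) (h₁₂ : r₁ ≤ r₂) (h₂₃ : r₂ ≤ r₃) :
    convexHull ℝ (unitGraph r₁ r₂ r₃) = envRegion r₁ r₂ r₃ := by
  apply (convexHull_min _ (convex_envRegion h₁ h₁₂ h₂₃)).antisymm
  · rintro p ⟨hp₁, hp₂, hp₃, hL, hU⟩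
    obtain ⟨a, b, ha, hb, hab, hp⟩ := Icc_subset_segment (𝕜 := ℝ) ⟨hL, hU⟩
    have key := convex_convexHull ℝ (unitGraph r₁ r₂ r₃)
      (lowerEnv_mem_convexHull r₁ r₂ r₃ hp₁ hp₂ hp₃)
      (upperEnv_mem_convexHull r₁ r₂ r₃ hp₁ hp₂ hp₃) ha hb hab
    convert key using 1
    ext i
    fin_cases i
    · simpa using hp.symm
    all_goals simp [← add_mul, hab]
  · rintro _ ⟨y₁, y₂, y₃, hy₁, hy₂, hy₃, rfl⟩
    exact ⟨hy₁, hy₂, hy₃, lowerEnv_le_unitTrilinear h₁ h₁₂ h₂₃ hy₁ hy₂ hy₃,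
      unitTrilinear_le_upperEnv h₁ (h₁.trans h₁₂) (h₁.trans (h₁₂.trans h₂₃)) hy₁ hy₂ hy₃⟩

lemma integral_max_zero_add_pow (c : ℝ) {n : ℕ} (hn : n ≠ 0) :
    ∫ x in (0 : ℝ)..1, max 0 (x + c) ^ n =
      (max 0 (1 + c) ^ (n + 1) - max 0 c ^ (n + 1)) / (n + 1) := by
  have hF (x : ℝ) (hx : x ≠ -c) :
      HasDerivAt (fun x => max 0 (x + c) ^ (n + 1) / (n + 1 : ℝ)) (max 0 (x + c) ^ n) x := by
    rcases lt_or_gt_of_ne hx with h | h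
    · have hev : (fun x => max 0 (x + c) ^ (n + 1) / (n + 1 : ℝ)) =ᶠ[nhds x] fun _ => 0 := by
        filter_upwards [Iio_mem_nhds h] with y hy
        rw [max_eq_left (by linarith [Set.mem_Iio.1 hy])]
        simp
      rw [max_eq_left (by linarith), zero_pow hn]
      exact (hasDerivAt_const x (0 : ℝ)).congr_of_eventuallyEq hev
    · have hev : (fun x => max 0 (x + c) ^ (n + 1) / (n + 1 : ℝ)) =ᶠ[nhds x]
          fun x => (x + c) ^ (n + 1) / (n + 1 : ℝ) := by
        filter_upwards [Ioi_mem_nhds h] with y hy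
        rw [max_eq_right (by linarith [Set.mem_Ioi.1 hy])]
      rw [max_eq_right (by linarith)]
      refine HasDerivAt.congr_of_eventuallyEq ?_ hev
      refine ((((hasDerivAt_id x).add_const c).pow (n + 1)).div_const (n + 1 : ℝ)).congr_deriv ?_
      rw [Nat.add_sub_cancel, Nat.cast_add_one, id_eq]
      field_simp
  have key := integral_eq_of_hasDerivAt_off_countable
    (fun x => max 0 (x + c) ^ (n + 1) / (n + 1 : ℝ)) (fun x => max 0 (x + c) ^ n)
    (a := 0) (b := 1) (Set.countable_singleton (-c)) (by fun_prop)
    (fun x hx => hF x hx.2) (Continuous.intervalIntegrable (by fun_prop) _ _)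
  rw [key]
  simp only [zero_add]
  ring

lemma integral_max_zero_add (c : ℝ) :
    ∫ x in (0 : ℝ)..1, max 0 (x + c) = (max 0 (1 + c) ^ 2 - max 0 c ^ 2) / 2 := by
  simpa only [pow_one, Nat.cast_one, one_add_one_eq_two] using
    integral_max_zero_add_pow c one_ne_zero

lemma integral_integral_max_zero_add (c : ℝ) :
    ∫ x in (0 : ℝ)..1, ∫ y in (0 : ℝ)..1, max 0 (x + y + c) =
      (max 0 (2 + c) ^ 3 - 2 * max 0 (1 + c) ^ 3 + max 0 c ^ 3) / 6 := by
  have inner (x : ℝ) : ∫ y in (0 : ℝ)..1, max 0 (x + y + c) =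
      max 0 (x + (1 + c)) ^ 2 / 2 - max 0 (x + c) ^ 2 / 2 := by
    have key := integral_max_zero_add (x + c)
    rw [show 1 + (x + c) = x + (1 + c) by ring] at key
    rw [← sub_div, ← key]
    congr! 3
    ring
  simp_rw [inner]
  rw [intervalIntegral.integral_sub (Continuous.intervalIntegrable (by fun_prop) _ _)
    (Continuous.intervalIntegrable (by fun_prop) _ _), intervalIntegral.integral_div,
    intervalIntegral.integral_div, integral_max_zero_add_pow _ two_ne_zero,
    integral_max_zero_add_pow _ two_ne_zero, show 1 + (1 + c) = 2 + c by ring]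
  norm_num
  ring

lemma integral_integral_integral_max_zero_add (c : ℝ) :
    ∫ x in (0 : ℝ)..1, ∫ y in (0 : ℝ)..1, ∫ z in (0 : ℝ)..1, max 0 (x + y + z + c) =
      (max 0 (3 + c) ^ 4 - 3 * max 0 (2 + c) ^ 4 + 3 * max 0 (1 + c) ^ 4 - max 0 c ^ 4) / 24 := by
  have inner (x : ℝ) : ∫ y in (0 : ℝ)..1, ∫ z in (0 : ℝ)..1, max 0 (x + y + z + c) =
      max 0 (x + (2 + c)) ^ 3 / 6 - max 0 (x + (1 + c)) ^ 3 / 3 + max 0 (x + c) ^ 3 / 6 := by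
    have key := integral_integral_max_zero_add (x + c)
    rw [show 1 + (x + c) = x + (1 + c) by ring, show 2 + (x + c) = x + (2 + c) by ring] at key
    trans ∫ y in (0 : ℝ)..1, ∫ z in (0 : ℝ)..1, max 0 (y + z + (x + c))
    · congr! 5
      ring
    · rw [key]
      ring
  simp_rw [inner]
  rw [intervalIntegral.integral_add (Continuous.intervalIntegrable (by fun_prop) _ _)
    (Continuous.intervalIntegrable (by fun_prop) _ _),
    intervalIntegral.integral_sub (Continuous.intervalIntegrable (by fun_prop) _ _)
    (Continuous.intervalIntegrable (by fun_prop) _ _), intervalIntegral.integral_div,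
    intervalIntegral.integral_div, intervalIntegral.integral_div,
    integral_max_zero_add_pow _ three_ne_zero, integral_max_zero_add_pow _ three_ne_zero,
    integral_max_zero_add_pow _ three_ne_zero, show 1 + (1 + c) = 2 + c by ring,
    show 1 + (2 + c) = 3 + c by ring]
  norm_num
  ring

lemma integral_min {c : ℝ} (hc : c ∈ Set.Icc (0 : ℝ) 1) :
    ∫ x in (0 : ℝ)..1, min c x = c - c ^ 2 / 2 := by
  have hmin (x : ℝ) : min c x = x - max 0 (x + -c) := by
    rcases le_total c x with h | h
    · rw [min_eq_left h, max_eq_right (by linarith)]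
      ring
    · rw [min_eq_right h, max_eq_left (by linarith)]
      ring
  simp_rw [hmin]
  rw [intervalIntegral.integral_sub (Continuous.intervalIntegrable (by fun_prop) _ _)
    (Continuous.intervalIntegrable (by fun_prop) _ _), integral_max_zero_add, integral_id,
    max_eq_right (by linarith [hc.2]), max_eq_left (by linarith [hc.1])]
  ring

lemma integral_min_sq {c : ℝ} (hc : c ∈ Set.Icc (0 : ℝ) 1) :
    ∫ x in (0 : ℝ)..1, min c x ^ 2 = c ^ 2 - 2 * c ^ 3 / 3 := by
  have hmin (x : ℝ) :
      min c x ^ 2 = x ^ 2 - 2 * c * max 0 (x + -c) - max 0 (x + -c) ^ 2 := by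
    rcases le_total c x with h | h
    · rw [min_eq_left h, max_eq_right (by linarith)]
      ring
    · rw [min_eq_right h, max_eq_left (by linarith)]
      ring
  simp_rw [hmin]
  rw [intervalIntegral.integral_sub (Continuous.intervalIntegrable (by fun_prop) _ _)
    (Continuous.intervalIntegrable (by fun_prop) _ _),
    intervalIntegral.integral_sub (Continuous.intervalIntegrable (by fun_prop) _ _)
    (Continuous.intervalIntegrable (by fun_prop) _ _), intervalIntegral.integral_const_mul,
    integral_max_zero_add, integral_pow, integral_max_zero_add_pow _ two_ne_zero,
    max_eq_right (by linarith [hc.2]), max_eq_left (by linarith [hc.1])]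
  norm_num
  ring

lemma integral_integral_min :
    ∫ x in (0 : ℝ)..1, ∫ y in (0 : ℝ)..1, min x y = 1 / 3 := by
  have inner : ∫ x in (0 : ℝ)..1, ∫ y in (0 : ℝ)..1, min x y =
      ∫ x in (0 : ℝ)..1, (x - x ^ 2 / 2) := by
    refine intervalIntegral.integral_congr fun x hx => ?_
    rw [Set.uIcc_of_le zero_le_one] at hx
    exact integral_min hx
  rw [inner, intervalIntegral.integral_sub (Continuous.intervalIntegrable (by fun_prop) _ _)
    (Continuous.intervalIntegrable (by fun_prop) _ _), intervalIntegral.integral_div,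
    integral_id, integral_pow]
  norm_num

lemma integral_integral_integral_min :
    ∫ x in (0 : ℝ)..1, ∫ y in (0 : ℝ)..1, ∫ z in (0 : ℝ)..1, min (min x y) z = 1 / 4 := by
  have inner : ∫ x in (0 : ℝ)..1, ∫ y in (0 : ℝ)..1, ∫ z in (0 : ℝ)..1, min (min x y) z =
      ∫ x in (0 : ℝ)..1, (x - x ^ 2 + x ^ 3 / 3) := by
    refine intervalIntegral.integral_congr fun x hx => ?_
    rw [Set.uIcc_of_le zero_le_one] at hx
    have inner' : ∫ y in (0 : ℝ)..1, ∫ z in (0 : ℝ)..1, min (min x y) z =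
        ∫ y in (0 : ℝ)..1, (min x y - min x y ^ 2 / 2) := by
      refine intervalIntegral.integral_congr fun y hy => ?_
      rw [Set.uIcc_of_le zero_le_one] at hy
      exact integral_min ⟨le_min hx.1 hy.1, min_le_of_left_le hx.2⟩
    rw [inner', intervalIntegral.integral_sub (Continuous.intervalIntegrable (by fun_prop) _ _)
      (Continuous.intervalIntegrable (by fun_prop) _ _), intervalIntegral.integral_div,
      integral_min hx, integral_min_sq hx]
    ring
  rw [inner, intervalIntegral.integral_add (Continuous.intervalIntegrable (by fun_prop) _ _)
    (Continuous.intervalIntegrable (by fun_prop) _ _),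
    intervalIntegral.integral_sub (Continuous.intervalIntegrable (by fun_prop) _ _)
    (Continuous.intervalIntegrable (by fun_prop) _ _), intervalIntegral.integral_div,
    integral_id, integral_pow, integral_pow]
  norm_num

/-- The unit cube in `ℝ × ℝ × ℝ`. -/
def unitCube : Set (ℝ × ℝ × ℝ) := Set.Icc 0 1 ×ˢ Set.Icc 0 1 ×ˢ Set.Icc 0 1

lemma isCompact_unitCube : IsCompact unitCube :=
  isCompact_Icc.prod (isCompact_Icc.prod isCompact_Icc)

lemma setIntegral_unitCube {f : ℝ × ℝ × ℝ → ℝ} (hf : Continuous f) :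
    ∫ y in unitCube, f y =
      ∫ x in (0 : ℝ)..1, ∫ y in (0 : ℝ)..1, ∫ z in (0 : ℝ)..1, f (x, y, z) := by
  have h := setIntegral_prod (μ := (volume : Measure ℝ)) (ν := (volume : Measure (ℝ × ℝ))) f
    (s := Set.Icc 0 1) (t := Set.Icc 0 1 ×ˢ Set.Icc 0 1)
    (hf.continuousOn.integrableOn_compact isCompact_unitCube)
  refine h.trans ?_
  rw [intervalIntegral.integral_of_le zero_le_one, integral_Icc_eq_integral_Ioc]
  congr 1 with x
  have h' := setIntegral_prod (μ := (volume : Measure ℝ)) (ν := (volume : Measure ℝ))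
    (fun y => f (x, y)) (s := Set.Icc 0 1) (t := Set.Icc 0 1)
    ((hf.comp (by fun_prop)).continuousOn.integrableOn_compact (isCompact_Icc.prod isCompact_Icc))
  refine h'.trans ?_
  rw [intervalIntegral.integral_of_le zero_le_one, integral_Icc_eq_integral_Ioc]
  congr 1 with y
  rw [intervalIntegral.integral_of_le zero_le_one, integral_Icc_eq_integral_Ioc]

lemma continuous_upperEnv (r₁ r₂ r₃ : ℝ) :
    Continuous fun y : ℝ × ℝ × ℝ => upperEnv r₁ r₂ r₃ y.1 y.2.1 y.2.2 := by
  unfold upperEnv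
  fun_prop

lemma continuous_lowerEnv (r₁ r₂ r₃ : ℝ) :
    Continuous fun y : ℝ × ℝ × ℝ => lowerEnv r₁ r₂ r₃ y.1 y.2.1 y.2.2 := by
  unfold lowerEnv
  fun_prop

lemma setIntegral_upperEnv (r₁ r₂ r₃ : ℝ) :
    ∫ y in unitCube, upperEnv r₁ r₂ r₃ y.1 y.2.1 y.2.2 = 1 / 4 + (r₁ + r₂ + r₃) / 3 := by
  have hint {f : ℝ × ℝ × ℝ → ℝ} (hf : Continuous f) : Integrable f (volume.restrict unitCube) :=
    hf.continuousOn.integrableOn_compact isCompact_unitCube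
  have e₀ : ∫ y in unitCube, min (min y.1 y.2.1) y.2.2 = 1 / 4 :=
    (setIntegral_unitCube (by fun_prop)).trans integral_integral_integral_min
  have e₁ : ∫ y in unitCube, min y.2.1 y.2.2 = 1 / 3 := by
    rw [setIntegral_unitCube (by fun_prop)]
    simp [integral_integral_min]
  have e₂ : ∫ y in unitCube, min y.1 y.2.2 = 1 / 3 := by
    rw [setIntegral_unitCube (by fun_prop)]
    simp [integral_integral_min]
  have e₃ : ∫ y in unitCube, min y.1 y.2.1 = 1 / 3 := by
    rw [setIntegral_unitCube (by fun_prop)]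
    simp [integral_integral_min]
  unfold upperEnv
  rw [integral_add (hint (by fun_prop)) (hint (by fun_prop)),
    integral_add (hint (by fun_prop)) (hint (by fun_prop)),
    integral_add (hint (by fun_prop)) (hint (by fun_prop)), integral_const_mul,
    integral_const_mul, integral_const_mul, e₀, e₁, e₂, e₃]
  ring

lemma setIntegral_lowerEnv (r₁ r₂ r₃ : ℝ) :
    ∫ y in unitCube, lowerEnv r₁ r₂ r₃ y.1 y.2.1 y.2.2 =
      1 / 24 + r₁ / 4 + r₂ / 6 + r₃ / 6 := by
  have hint {f : ℝ × ℝ × ℝ → ℝ} (hf : Continuous f) : Integrable f (volume.restrict unitCube) :=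
    hf.continuousOn.integrableOn_compact isCompact_unitCube
  have e₁ : ∫ y in unitCube, max 0 (y.1 + y.2.1 + y.2.2 - 1) = 13 / 24 := by
    rw [setIntegral_unitCube (by fun_prop)]
    simp_rw [sub_eq_add_neg]
    rw [integral_integral_integral_max_zero_add]
    norm_num
  have e₂ : ∫ y in unitCube, max 0 (y.1 + y.2.1 + y.2.2 - 2) = 1 / 24 := by
    rw [setIntegral_unitCube (by fun_prop)]
    simp_rw [sub_eq_add_neg]
    rw [integral_integral_integral_max_zero_add]
    norm_num
  have e : ∫ x in (0 : ℝ)..1, ∫ y in (0 : ℝ)..1, max 0 (x + y - 1) = 1 / 6 := by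
    simp_rw [sub_eq_add_neg]
    rw [integral_integral_max_zero_add]
    norm_num
  have e₃ : ∫ y in unitCube, max 0 (y.1 + y.2.2 - 1) = 1 / 6 := by
    rw [setIntegral_unitCube (by fun_prop)]
    simp [e]
  have e₄ : ∫ y in unitCube, max 0 (y.1 + y.2.1 - 1) = 1 / 6 := by
    rw [setIntegral_unitCube (by fun_prop)]
    simp [e]
  unfold lowerEnv
  rw [integral_add (hint (by fun_prop)) (hint (by fun_prop)),
    integral_add (hint (by fun_prop)) (hint (by fun_prop)),
    integral_add (hint (by fun_prop)) (hint (by fun_prop)), integral_const_mul,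
    integral_const_mul, integral_const_mul, integral_const_mul, e₁, e₂, e₃, e₄]
  ring

lemma measurePreserving_fin_four :
    MeasurePreserving (fun p : Fin 4 → ℝ => (p 0, p 1, p 2, p 3)) := by
  have h₁ := volume_preserving_piFinSuccAbove (fun _ : Fin 4 => ℝ) 0
  have h₂ := volume_preserving_piFinSuccAbove (fun _ : Fin 3 => ℝ) 0
  have h₃ := volume_preserving_finTwoArrow ℝ
  exact ((MeasurePreserving.id volume).prod ((MeasurePreserving.id volume).prod h₃)).comp
    (((MeasurePreserving.id volume).prod h₂).comp h₁)

lemma volume_envRegion {r₁ r₂ r₃ : ℝ} (h₁ : 0 ≤ r₁) (h₁₂ : r₁ ≤ r₂) (h₂₃ : r₂ ≤ r₃) :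
    volume (envRegion r₁ r₂ r₃) = ENNReal.ofReal (5 / 24 + r₁ / 12 + r₂ / 6 + r₃ / 6) := by
  let L : ℝ × ℝ × ℝ → ℝ := fun y => lowerEnv r₁ r₂ r₃ y.1 y.2.1 y.2.2
  let U : ℝ × ℝ × ℝ → ℝ := fun y => upperEnv r₁ r₂ r₃ y.1 y.2.1 y.2.2
  have hL : Continuous L := continuous_lowerEnv r₁ r₂ r₃
  have hU : Continuous U := continuous_upperEnv r₁ r₂ r₃
  let S : Set (ℝ × ℝ × ℝ × ℝ) := {q | q.2 ∈ unitCube ∧ L q.2 ≤ q.1 ∧ q.1 ≤ U q.2}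
  have hS : MeasurableSet S := by
    refine ((isCompact_unitCube.isClosed.preimage continuous_snd).inter
      ((isClosed_le (hL.comp continuous_snd) continuous_fst).inter
      (isClosed_le continuous_fst (hU.comp continuous_snd)))).measurableSet
  have hpre : envRegion r₁ r₂ r₃ = (fun p : Fin 4 → ℝ => (p 0, p 1, p 2, p 3)) ⁻¹' S := by
    ext p
    simp only [envRegion, S, L, U, unitCube, Set.mem_ofPred_eq, Set.mem_preimage, Set.mem_prod]
    tauto
  have hslice (y : ℝ × ℝ × ℝ) : volume ((fun x => (x, y)) ⁻¹' S) =
      unitCube.indicator (fun y => ENNReal.ofReal (U y - L y)) y := by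
    by_cases hy : y ∈ unitCube
    · rw [Set.indicator_of_mem hy, ← Real.volume_Icc]
      congr 1 with x
      simp [S, hy]
    · rw [Set.indicator_of_notMem hy, ← measure_empty (μ := (volume : Measure ℝ))]
      congr 1 with x
      simp [S, hy]
  have hint {f : ℝ × ℝ × ℝ → ℝ} (hf : Continuous f) : Integrable f (volume.restrict unitCube) :=
    hf.continuousOn.integrableOn_compact isCompact_unitCube
  have hcube := isCompact_unitCube.isClosed.measurableSet
  rw [hpre, measurePreserving_fin_four.measure_preimage hS.nullMeasurableSet,
    Measure.volume_eq_prod, Measure.prod_apply_symm hS]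
  simp_rw [hslice]
  rw [lintegral_indicator hcube, ← ofReal_integral_eq_lintegral_ofReal (f := fun y => U y - L y) ((hint hU).sub (hint hL)) ?_,
    integral_sub (hint hU) (hint hL), setIntegral_upperEnv, setIntegral_lowerEnv]
  · congr 1
    ring
  · refine (ae_restrict_iff' hcube).2 (ae_of_all _ fun y hy => sub_nonneg.2 ?_)
    obtain ⟨hy₁, hy₂, hy₃⟩ := hy
    exact (lowerEnv_le_unitTrilinear h₁ h₁₂ h₂₃ hy₁ hy₂ hy₃).trans
      (unitTrilinear_le_upperEnv h₁ (h₁.trans h₁₂) (h₁.trans (h₁₂.trans h₂₃)) hy₁ hy₂ hy₃)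

/-- The linear part of the affine map carrying the graph over the unit cube to the graph of
`x₁x₂x₃` over the box with lower corner `a` and side lengths `b`. -/
def boxMatrix (a₁ a₂ a₃ b₁ b₂ b₃ : ℝ) : Matrix (Fin 4) (Fin 4) ℝ :=
  !![b₁ * b₂ * b₃, b₁ * a₂ * a₃, a₁ * b₂ * a₃, a₁ * a₂ * b₃;
    0, b₁, 0, 0; 0, 0, b₂, 0; 0, 0, 0, b₃]

lemma det_boxMatrix (a₁ a₂ a₃ b₁ b₂ b₃ : ℝ) :
    (boxMatrix a₁ a₂ a₃ b₁ b₂ b₃).det = (b₁ * b₂ * b₃) ^ 2 := by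
  simp [boxMatrix, Matrix.det_succ_column_zero, Fin.sum_univ_succ]
  ring

open scoped Pointwise in
lemma boxMatrix_image_unitGraph (a₁ a₂ a₃ : ℝ) {b₁ b₂ b₃ : ℝ} (hb₁ : 0 < b₁) (hb₂ : 0 < b₂)
    (hb₃ : 0 < b₃) :
    {p : Fin 4 → ℝ | ∃ x₁ x₂ x₃ : ℝ, x₁ ∈ Set.Icc a₁ (a₁ + b₁) ∧ x₂ ∈ Set.Icc a₂ (a₂ + b₂) ∧
      x₃ ∈ Set.Icc a₃ (a₃ + b₃) ∧ p = ![x₁ * x₂ * x₃, x₁, x₂, x₃]} =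
    ![a₁ * a₂ * a₃, a₁, a₂, a₃] +ᵥ
      Matrix.toLin' (boxMatrix a₁ a₂ a₃ b₁ b₂ b₃) '' unitGraph (a₁ / b₁) (a₂ / b₂) (a₃ / b₃) := by
  have hmap (y₁ y₂ y₃ : ℝ) : ![a₁ * a₂ * a₃, a₁, a₂, a₃] +
      Matrix.toLin' (boxMatrix a₁ a₂ a₃ b₁ b₂ b₃)
        ![unitTrilinear (a₁ / b₁) (a₂ / b₂) (a₃ / b₃) y₁ y₂ y₃, y₁, y₂, y₃] =
      ![(a₁ + b₁ * y₁) * (a₂ + b₂ * y₂) * (a₃ + b₃ * y₃),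
        a₁ + b₁ * y₁, a₂ + b₂ * y₂, a₃ + b₃ * y₃] := by
    ext i
    fin_cases i
    · simp [boxMatrix, unitTrilinear]
      field_simp
      ring
    all_goals simp [boxMatrix, mul_comm]
  have hpre {a b x : ℝ} (hb : 0 < b) (hx : x ∈ Set.Icc a (a + b)) :
      (x - a) / b ∈ Set.Icc (0 : ℝ) 1 ∧ a + b * ((x - a) / b) = x :=
    ⟨⟨div_nonneg (by linarith [hx.1]) hb.le, (div_le_one hb).2 (by linarith [hx.2])⟩,
      by rw [mul_div_cancel₀ _ hb.ne']; ring⟩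
  have himg {a b y : ℝ} (hb : 0 < b) (hy : y ∈ Set.Icc (0 : ℝ) 1) :
      a + b * y ∈ Set.Icc a (a + b) :=
    ⟨by nlinarith [hy.1], by nlinarith [hy.2]⟩
  apply Set.Subset.antisymm
  · rintro _ ⟨x₁, x₂, x₃, hx₁, hx₂, hx₃, rfl⟩
    obtain ⟨hy₁, e₁⟩ := hpre hb₁ hx₁
    obtain ⟨hy₂, e₂⟩ := hpre hb₂ hx₂
    obtain ⟨hy₃, e₃⟩ := hpre hb₃ hx₃
    refine ⟨_, ⟨_, ⟨_, _, _, hy₁, hy₂, hy₃, rfl⟩, rfl⟩, ?_⟩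
    refine (hmap _ _ _).trans ?_
    rw [e₁, e₂, e₃]
  · rintro _ ⟨_, ⟨_, ⟨y₁, y₂, y₃, hy₁, hy₂, hy₃, rfl⟩, rfl⟩, rfl⟩
    exact ⟨_, _, _, himg hb₁ hy₁, himg hb₂ hy₂, himg hb₃ hy₃, hmap _ _ _⟩

theorem volume_PH_case1 (c₁ c₂ c₃ ℓ₁ ℓ₂ ℓ₃ : ℝ)
    (hc₁ : 0 ≤ c₁) (hc₂ : 0 ≤ c₂) (hc₃ : 0 ≤ c₃)
    (hℓ₁ : 0 < ℓ₁) (hℓ₂ : 0 < ℓ₂) (hℓ₃ : 0 < ℓ₃)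
    (hΩ₁ : c₁ / ℓ₁ ≤ c₂ / ℓ₂) (hΩ₂ : c₂ / ℓ₂ ≤ c₃ / ℓ₃)
    (h : 1 ≤ c₁ / ℓ₁) :
    volume (PH c₁ c₂ c₃ ℓ₁ ℓ₂ ℓ₃) =
      ENNReal.ofReal (8 / 3 * ℓ₁ ^ 2 * ℓ₂ ^ 2 * ℓ₃ ^ 2 *
        (c₁ / ℓ₁ + 2 * (c₂ / ℓ₂) + 2 * (c₃ / ℓ₃))) := by
  have hr {c ℓ : ℝ} (hℓ : 0 < ℓ) : (c - ℓ) / (2 * ℓ) = (c / ℓ - 1) / 2 := by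
    field_simp
  have hgraph := boxMatrix_image_unitGraph (c₁ - ℓ₁) (c₂ - ℓ₂) (c₃ - ℓ₃)
    (mul_pos two_pos hℓ₁) (mul_pos two_pos hℓ₂) (mul_pos two_pos hℓ₃)
  rw [hr hℓ₁, hr hℓ₂, hr hℓ₃] at hgraph
  have htop (c ℓ : ℝ) : c + ℓ = c - ℓ + 2 * ℓ := by ring
  rw [PH, htop c₁, htop c₂, htop c₃, hgraph, convexHull_vadd, measure_vadd,
    ← LinearMap.image_convexHull,
    convexHull_unitGraph (by linarith) (by linarith) (by linarith),
    Measure.addHaar_image_linearMap, LinearMap.det_toLin', det_boxMatrix,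
    volume_envRegion (by linarith) (by linarith) (by linarith),
    ← ENNReal.ofReal_mul (abs_nonneg _), abs_of_nonneg (sq_nonneg _)]
  congr 1
  ring
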